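/- Let W=(w_1,…,w_q) be a family of q points in ℂ ∖ 𝔻, not necessarily distinct. Let K be a compact subset of ℂ ∖ (𝔻 ∪ W) with connected complement, L a compact subset of 𝔻, and h ∈ A(K). Then for every ε > 0, every family (a_1,…,a_q) of complex numbers, and every integer p ≥ 1, there exists a polynomial P(z) = ∑_{k=p}^r b_k z^k (i.e., with valuation at least p) such that: a) P(w_i) ≠ 0 and P(w_i) ≠ a_i for every 1 ≤ i ≤ q; b) sup_{z∈K} |P(z) − h(z)| ≤ ε; c) sup_{z∈L} |P(z)| ≤ ε. -/

import Mathlib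

open Polynomial Filter Finset Metric Topology

noncomputable section

/-- Coefficient sequence extended to integer indices, with `a k = 0` for `k < 0`. -/
def acoefZ (a : ℕ → ℂ) (k : ℤ) : ℂ := if 0 ≤ k then a k.toNat else 0

/-- The Hankel determinant `C_{m,n} = det (a_{m-n+1+i+j})_{0 ≤ i,j ≤ n-1}`. -/
def hankelDet (a : ℕ → ℂ) (m n : ℕ) : ℂ :=
  Matrix.det (Matrix.of fun i j : Fin n => acoefZ a ((m : ℤ) - n + 1 + i + j))

/-- `IsPade a m n P Q` : the rational function `P/Q` is the Padé approximant of type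
`(m,n)` of the formal power series `∑ a_k z^k`. -/
def IsPade (a : ℕ → ℂ) (m n : ℕ) (P Q : Polynomial ℂ) : Prop :=
  P.natDegree ≤ m ∧ Q.natDegree ≤ n ∧ IsCoprime P Q ∧ Q.coeff 0 = 1 ∧
    ∀ j ≤ m + n, (∑ i ∈ Finset.range (j + 1), Q.coeff i * a (j - i)) = P.coeff j

/-- `𝒟_{m,n}` : the set of coefficient sequences whose Hankel determinant `C_{m,n}`
does not vanish. -/
def Dset (m n : ℕ) : Set (ℕ → ℂ) := {a | hankelDet a m n ≠ 0}

/-- `𝒩_{m,n}` : the subset of `𝒟_{m,n}` of series whose Padé denominator has exact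
degree `n`. -/
def Nset (m n : ℕ) : Set (ℕ → ℂ) :=
  {a | hankelDet a m n ≠ 0 ∧
    ∃ P Q : Polynomial ℂ, IsPade a m n P Q ∧ Q.degree = (n : WithBot ℕ)}

/-- The open unit disc in `ℂ`. -/
def unitD : Set ℂ := Metric.ball (0 : ℂ) 1

/-- The submodule of `ℂ → ℂ` of functions holomorphic on `Ω` (normalized to vanish
outside `Ω`, so that a function is determined by its restriction to `Ω`). -/
def holSubmodule (Ω : Set ℂ) : Submodule ℂ (ℂ → ℂ) where
  carrier := {f | DifferentiableOn ℂ f Ω ∧ ∀ z ∉ Ω, f z = 0}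
  add_mem' := fun hf hg => ⟨hf.1.add hg.1, fun z hz => by simp [hf.2 z hz, hg.2 z hz]⟩
  zero_mem' := ⟨differentiableOn_const 0, fun _ _ => rfl⟩
  smul_mem' := fun c f hf => ⟨hf.1.const_smul c, fun z hz => by simp [hf.2 z hz]⟩

/-- `H(Ω)`, the space of holomorphic functions on `Ω`. -/
abbrev Hol (Ω : Set ℂ) := ↥(holSubmodule Ω)

/-- The topology of uniform convergence on compact subsets of `Ω` on `H(Ω)`. -/
instance holTop (Ω : Set ℂ) : TopologicalSpace (Hol Ω) :=
  TopologicalSpace.induced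
    (fun f : Hol Ω => UniformOnFun.ofFun {K : Set Ω | IsCompact K} fun z : Ω => f.1 z)
    inferInstance

/-- The `k`-th Taylor coefficient at `0` of a function `f`. -/
def tc (f : ℂ → ℂ) (k : ℕ) : ℂ := iteratedDeriv k f 0 / k.factorial

/-- `f` is a uniform limit of polynomials on `K`. -/
def PolyApprox (K : Set ℂ) (f : ℂ → ℂ) : Prop :=
  ∀ ε > 0, ∃ P : Polynomial ℂ, ∀ z ∈ K, ‖P.eval z - f z‖ ≤ ε

namespace PolyApprox

variable {K : Set ℂ} {f g : ℂ → ℂ}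

theorem congr (hf : PolyApprox K f) (h : ∀ z ∈ K, f z = g z) : PolyApprox K g := by
  intro ε hε
  obtain ⟨P, hP⟩ := hf ε hε
  exact ⟨P, fun z hz => by rw [← h z hz]; exact hP z hz⟩

theorem eval (P : Polynomial ℂ) : PolyApprox K fun z => P.eval z :=
  fun ε hε => ⟨P, fun z _ => by simpa using hε.le⟩

theorem const (c : ℂ) : PolyApprox K fun _ => c := by
  simpa using eval (K := K) (Polynomial.C c)

theorem id : PolyApprox K fun z => z := by
  simpa using eval (K := K) (Polynomial.X : Polynomial ℂ)

theorem of_forall_approx (h : ∀ ε > 0, ∃ g, PolyApprox K g ∧ ∀ z ∈ K, ‖g z - f z‖ ≤ ε) :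
    PolyApprox K f := by
  intro ε hε
  obtain ⟨g, hg, hgf⟩ := h (ε / 2) (half_pos hε)
  obtain ⟨P, hP⟩ := hg (ε / 2) (half_pos hε)
  refine ⟨P, fun z hz => ?_⟩
  calc ‖P.eval z - f z‖ = ‖(P.eval z - g z) + (g z - f z)‖ := by ring_nf
    _ ≤ ε / 2 + ε / 2 := (norm_add_le _ _).trans (add_le_add (hP z hz) (hgf z hz))
    _ = ε := by ring

theorem add (hf : PolyApprox K f) (hg : PolyApprox K g) : PolyApprox K fun z => f z + g z := by
  intro ε hε
  obtain ⟨P, hP⟩ := hf (ε / 2) (half_pos hε)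
  obtain ⟨Q, hQ⟩ := hg (ε / 2) (half_pos hε)
  refine ⟨P + Q, fun z hz => ?_⟩
  calc ‖(P + Q).eval z - (f z + g z)‖ = ‖(P.eval z - f z) + (Q.eval z - g z)‖ := by
        rw [eval_add]; ring_nf
    _ ≤ ε / 2 + ε / 2 := (norm_add_le _ _).trans (add_le_add (hP z hz) (hQ z hz))
    _ = ε := by ring

theorem exists_bound (hK : IsCompact K) (hf : PolyApprox K f) : ∃ M > 0, ∀ z ∈ K, ‖f z‖ ≤ M := by
  obtain ⟨P, hP⟩ := hf 1 one_pos
  obtain ⟨M, hM⟩ := hK.exists_bound_of_continuousOn (f := fun z => P.eval z)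
    P.continuous.continuousOn
  refine ⟨|M| + 1, by positivity, fun z hz => ?_⟩
  calc ‖f z‖ = ‖P.eval z - (P.eval z - f z)‖ := by ring_nf
    _ ≤ |M| + 1 := (norm_sub_le _ _).trans
        (add_le_add ((hM z hz).trans (le_abs_self M)) (hP z hz))

theorem mul (hK : IsCompact K) (hf : PolyApprox K f) (hg : PolyApprox K g) :
    PolyApprox K fun z => f z * g z := by
  intro ε hε
  obtain ⟨A, hA, hfA⟩ := exists_bound hK hf
  obtain ⟨Q, hQ⟩ := hg (ε / (2 * A)) (by positivity)
  obtain ⟨B, hB, hQB⟩ := exists_bound hK (eval (K := K) Q)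
  obtain ⟨P, hP⟩ := hf (ε / (2 * B)) (by positivity)
  refine ⟨P * Q, fun z hz => ?_⟩
  calc ‖(P * Q).eval z - f z * g z‖
      = ‖(P.eval z - f z) * Q.eval z + f z * (Q.eval z - g z)‖ := by
        rw [eval_mul]; ring_nf
    _ ≤ ‖P.eval z - f z‖ * ‖Q.eval z‖ + ‖f z‖ * ‖Q.eval z - g z‖ := by
        rw [← norm_mul, ← norm_mul]; exact norm_add_le _ _
    _ ≤ ε / (2 * B) * B + A * (ε / (2 * A)) := by
        gcongr
        exacts [hP z hz, hQB z hz, hfA z hz, hQ z hz]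
    _ = ε := by field_simp; norm_num

theorem const_mul (hK : IsCompact K) (c : ℂ) (hf : PolyApprox K f) :
    PolyApprox K fun z => c * f z :=
  mul hK (const c) hf

theorem sub (hK : IsCompact K) (hf : PolyApprox K f) (hg : PolyApprox K g) :
    PolyApprox K fun z => f z - g z :=
  (hf.add (hg.const_mul hK (-1))).congr fun z _ => by ring

theorem pow (hK : IsCompact K) (hf : PolyApprox K f) (n : ℕ) :
    PolyApprox K fun z => f z ^ n := by
  induction n with
  | zero => simpa using const (K := K) 1
  | succ n ih => exact (ih.mul hK hf).congr fun z _ => by ring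

theorem sum {ι : Type*} (s : Finset ι) {F : ι → ℂ → ℂ} (h : ∀ i ∈ s, PolyApprox K (F i)) :
    PolyApprox K fun z => ∑ i ∈ s, F i z := by
  classical
  induction s using Finset.induction_on with
  | empty => simpa using const (K := K) 0
  | insert i s hi ih =>
    have := (h i (mem_insert_self i s)).add (ih fun j hj => h j (mem_insert_of_mem hj))
    exact this.congr fun z _ => by rw [sum_insert hi]

theorem comp_differentiableOn (hK : IsCompact K) (hf : PolyApprox K f) {ρ : ℝ} (hρ : ρ < 1)
    (hfρ : ∀ z ∈ K, ‖f z‖ ≤ ρ) {H : ℂ → ℂ} (hH : DifferentiableOn ℂ H (ball 0 1)) :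
    PolyApprox K fun z => H (f z) := by
  obtain ⟨r, hρr, hr⟩ := exists_between (max_lt hρ zero_lt_one)
  obtain ⟨s, hrs, hs⟩ := exists_between hr
  have hr0 : 0 < r := (le_max_right _ _).trans_lt hρr
  have hs0 : 0 < s := hr0.trans hrs
  lift r to NNReal using hr0.le
  lift s to NNReal using hs0.le
  have hps := (hH.mono (closedBall_subset_ball hs)).hasFPowerSeriesOnBall
    (by exact_mod_cast hs0)
  have hlim := hps.tendstoUniformlyOn (r' := r) (by exact_mod_cast hrs)
  rw [Metric.tendstoUniformlyOn_iff] at hlim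
  refine of_forall_approx fun ε hε => ?_
  obtain ⟨n, hn⟩ := (hlim ε hε).exists
  refine ⟨fun z => (cauchyPowerSeries H 0 s).partialSum n (f z), ?_, fun z hz => ?_⟩
  · refine (sum (Finset.range n) (F := fun k z => (cauchyPowerSeries H 0 s).coeff k * f z ^ k)
      fun k _ => (hf.pow hK k).const_mul hK _).congr fun z _ => ?_
    simp only [FormalMultilinearSeries.partialSum]
    refine Finset.sum_congr rfl fun k _ => ?_
    rw [FormalMultilinearSeries.apply_eq_pow_smul_coeff, smul_eq_mul, mul_comm]
  · have := hn (f z) (by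
      rw [mem_ball_zero_iff]
      exact (hfρ z hz).trans_lt ((le_max_left _ _).trans_lt hρr))
    rw [dist_comm, dist_eq_norm, zero_add] at this
    exact this.le

end PolyApprox

/-- A property of points of a preconnected set `U` off the closed set `K` spreads over `U` if it
passes to all points that are close relative to the distance to `K`. -/
theorem IsPreconnected.spread_of_local {K U : Set ℂ} (hK : IsClosed K) (hU : IsPreconnected U)
    (hUK : Disjoint U K) {T : ℂ → Prop}
    (step : ∀ b ∈ U, ∀ b' ∈ U, (∀ z ∈ K, ‖b' - b‖ ≤ ‖z - b‖ / 2) → T b → T b')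
    {x y : ℂ} (hx : x ∈ U) (hy : y ∈ U) : T x → T y := by
  refine hU.induction₂' (fun x y => T x → T y) (fun x hx => ?_)
    (fun x y z _ _ _ h₁ h₂ h => h₂ (h₁ h)) hx hy
  obtain ⟨d, hd, hdK⟩ := Metric.isOpen_iff.mp hK.isOpen_compl x (hUK.notMem_of_mem_left hx)
  have hz : ∀ z ∈ K, d ≤ ‖z - x‖ := fun z hz => by
    by_contra! h
    exact hdK (mem_ball_iff_norm.mpr h) hz
  filter_upwards [self_mem_nhdsWithin,
    mem_nhdsWithin_of_mem_nhds (ball_mem_nhds x (by positivity : 0 < d / 3))] with b hbU hb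
  rw [mem_ball_iff_norm] at hb
  constructor
  · refine step x hx b hbU fun z hzK => ?_
    linarith [hz z hzK]
  · refine step b hbU x hx fun z hzK => ?_
    have : ‖z - x‖ ≤ ‖z - b‖ + ‖b - x‖ := norm_sub_le_norm_sub_add_norm_sub _ _ _
    rw [norm_sub_rev]
    linarith [hz z hzK]

namespace PolyApprox

variable {K : Set ℂ}

theorem differentiableOn_one_sub_inv : DifferentiableOn ℂ (fun t : ℂ => (1 - t)⁻¹) (ball 0 1) := by
  intro t ht
  have : 1 - t ≠ 0 := fun h => by
    rw [mem_ball_zero_iff, ← sub_eq_zero.mp h] at ht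
    simp at ht
  exact ((differentiableAt_const 1).sub differentiableAt_id |>.inv this).differentiableWithinAt

theorem norm_shift_le {b b' z : ℂ} (hzb : z - b ≠ 0) (h : ‖b' - b‖ ≤ ‖z - b‖ / 2) :
    ‖(b' - b) * (z - b)⁻¹‖ ≤ 1 / 2 := by
  have : 0 < ‖z - b‖ := norm_pos_iff.mpr hzb
  rw [norm_mul, norm_inv, ← div_eq_mul_inv, div_le_iff₀ this]
  linarith

/-- Pole pushing: Cauchy kernels with pole off `K` are limits of polynomials. -/
theorem sub_inv (hK : IsCompact K) (hKc : IsConnected Kᶜ) {a : ℂ} (ha : a ∉ K) :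
    PolyApprox K fun z => (z - a)⁻¹ := by
  obtain ⟨R, hR0, hR⟩ : ∃ R > 0, ∀ z ∈ K, ‖z‖ ≤ R := exists_bound hK PolyApprox.id
  have hfar : ‖((2 * R : ℝ) : ℂ)‖ = 2 * R := by
    rw [Complex.norm_real, Real.norm_of_nonneg (by positivity)]
  set A : ℂ := ((2 * R : ℝ) : ℂ) with hA
  have hA0 : A ≠ 0 := by
    rw [← norm_pos_iff, hfar]; positivity
  have hAK : A ∉ K := fun h => by
    have := hR A h
    linarith
  refine hKc.isPreconnected.spread_of_local hK.isClosed disjoint_compl_left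
    (T := fun a => PolyApprox K fun z => (z - a)⁻¹) ?_ (x := A) hAK ha ?_
  · intro b hb b' _ hbb hT
    have h0 : ∀ z ∈ K, z - b ≠ 0 := fun z hz h => hb (sub_eq_zero.mp h ▸ hz)
    refine (hT.mul hK ((hT.const_mul hK (b' - b)).comp_differentiableOn hK (ρ := 1 / 2)
      (by norm_num) (fun z hz => norm_shift_le (h0 z hz) (hbb z hz)) differentiableOn_one_sub_inv)).congr
      fun z hz => ?_
    rw [← mul_inv]
    congr 1
    have := h0 z hz
    field_simp
    ring
  · refine (((PolyApprox.id.const_mul hK A⁻¹).comp_differentiableOn hK (ρ := 1 / 2) (by norm_num)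
      (fun z hz => ?_) differentiableOn_one_sub_inv).const_mul hK (-A⁻¹)).congr fun z hz => ?_
    · rw [norm_mul, norm_inv, hfar, inv_mul_le_iff₀ (by positivity)]
      linarith [hR z hz]
    · rw [neg_mul, ← mul_inv, ← inv_neg]
      congr 1
      field_simp
      ring

/-- The principal branch of `√(1 - t)`. -/
def sqrtOneSub (t : ℂ) : ℂ := Complex.exp (Complex.log (1 - t) / 2)

theorem one_sub_mem_slitPlane {t : ℂ} (ht : ‖t‖ < 1) : 1 - t ∈ Complex.slitPlane := by
  left
  have := (Complex.abs_re_le_norm t).trans_lt ht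
  simp only [Complex.sub_re, Complex.one_re]
  linarith [(abs_lt.mp this).2]

theorem differentiableOn_sqrtOneSub : DifferentiableOn ℂ sqrtOneSub (ball 0 1) := by
  intro t ht
  rw [mem_ball_zero_iff] at ht
  exact ((((differentiableAt_const 1).sub differentiableAt_id).clog
    (one_sub_mem_slitPlane ht)).div_const 2).cexp.differentiableWithinAt

theorem sqrtOneSub_sq {t : ℂ} (ht : ‖t‖ < 1) : sqrtOneSub t ^ 2 = 1 - t := by
  rw [sqrtOneSub, ← Complex.exp_nat_mul, Nat.cast_ofNat, mul_div_cancel₀ _ two_ne_zero,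
    Complex.exp_log (Complex.slitPlane_ne_zero (one_sub_mem_slitPlane ht))]

theorem re_sqrtOneSub_pos {t : ℂ} (ht : ‖t‖ < 1) : 0 < (sqrtOneSub t).re := by
  rw [sqrtOneSub, Complex.exp_re]
  refine mul_pos (Real.exp_pos _) (Real.cos_pos_of_mem_Ioo ?_)
  have h2 : (Complex.log (1 - t) / 2).im = Complex.arg (1 - t) / 2 := by
    rw [← Complex.log_im]
    exact Complex.div_ofNat_im _ 2
  have h₁ := Complex.neg_pi_lt_arg (1 - t)
  have h₃ := (Complex.arg_le_pi (1 - t)).lt_of_ne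
    (Complex.mem_slitPlane_iff_arg.mp (one_sub_mem_slitPlane ht)).1
  rw [h2]
  constructor <;> linarith

theorem re_mul_pos_of_sq {s σ : ℂ} (hs : 0 < s.re) (hσ : 0 < σ.re) (hs2 : 0 < (s ^ 2).re)
    (hσ2 : 0 < (σ ^ 2).re) : 0 < (s * σ).re := by
  simp only [pow_two, Complex.mul_re] at *
  have h₁ : |s.im| < s.re := abs_lt_of_sq_lt_sq (by nlinarith) hs.le
  have h₂ : |σ.im| < σ.re := abs_lt_of_sq_lt_sq (by nlinarith) hσ.le
  have : s.im * σ.im < s.re * σ.re := by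
    calc s.im * σ.im ≤ |s.im| * |σ.im| := by rw [← abs_mul]; exact le_abs_self _
      _ < s.re * σ.re := mul_lt_mul'' h₁ h₂ (abs_nonneg _) (abs_nonneg _)
  linarith

theorem re_pos_of_norm_one_sub {x t : ℂ} (h : x = 1 - t) (ht : ‖t‖ < 1) : 0 < x.re := by
  have := (Complex.abs_re_le_norm t).trans_lt ht
  rw [h, Complex.sub_re, Complex.one_re]
  linarith [(abs_lt.mp this).2]

/-- A branch of `√((z - b) / (z - c))` which is a limit of polynomials on `K`, where `c` and `b`
are joined off `K` within distance `2` of `c`. -/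
theorem exists_sqrt_ratio (hK : IsCompact K) (hKc : IsConnected Kᶜ) {U : Set ℂ}
    (hU : IsPreconnected U) (hUK : Disjoint U K) {c b : ℂ} (hUc : U ⊆ closedBall c 2)
    (hc : c ∈ U) (hb : b ∈ U) :
    ∃ S : ℂ → ℂ, PolyApprox K S ∧ ∀ z ∈ K, S z ^ 2 * (z - c) = z - b ∧
      (4 ≤ ‖z - c‖ → 0 < (S z).re) := by
  refine hU.spread_of_local hK.isClosed hUK (T := fun b => ∃ S : ℂ → ℂ, PolyApprox K S ∧
    ∀ z ∈ K, S z ^ 2 * (z - c) = z - b ∧ (4 ≤ ‖z - c‖ → 0 < (S z).re)) ?_ hc hb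
    ⟨fun _ => 1, PolyApprox.const 1, fun z _ => by simp⟩
  rintro b hb b' - hbb ⟨S, hS, hSz⟩
  have hbK := hUK.notMem_of_mem_left hb
  have h0 : ∀ z ∈ K, z - b ≠ 0 := fun z hz h => hbK (sub_eq_zero.mp h ▸ hz)
  have hle : ∀ z ∈ K, ‖(b' - b) * (z - b)⁻¹‖ ≤ 1 / 2 := fun z hz =>
    norm_shift_le (h0 z hz) (hbb z hz)
  have hlt : ∀ z ∈ K, ‖(b' - b) * (z - b)⁻¹‖ < 1 := fun z hz =>
    (hle z hz).trans_lt (by norm_num)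
  refine ⟨fun z => S z * sqrtOneSub ((b' - b) * (z - b)⁻¹), hS.mul hK
    (((sub_inv hK hKc hbK).const_mul hK (b' - b)).comp_differentiableOn hK (by norm_num) hle
      differentiableOn_sqrtOneSub), fun z hz => ⟨?_, fun h4 => ?_⟩⟩
  · rw [mul_pow, sqrtOneSub_sq (hlt z hz), mul_right_comm, (hSz z hz).1]
    have := h0 z hz
    field_simp
    ring
  · refine re_mul_pos_of_sq ((hSz z hz).2 h4) (re_sqrtOneSub_pos (hlt z hz)) ?_
      (re_pos_of_norm_one_sub (sqrtOneSub_sq (hlt z hz)) (hlt z hz))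
    have hzc : 0 < ‖z - c‖ := by linarith
    refine re_pos_of_norm_one_sub (t := (b - c) / (z - c)) ?_ ?_
    · have h1 := (hSz z hz).1
      have : z - c ≠ 0 := norm_pos_iff.mp hzc
      field_simp
      rw [h1]; ring
    · rw [norm_div, div_lt_one hzc]
      have := mem_closedBall_iff_norm.mp (hUc hb)
      linarith

end PolyApprox

/-- An integrable majorant on the plane of the error in approximating the Cauchy kernel. -/
def errorKernel (t : ℝ) : ℝ := 4000000 / (t * (1 + t ^ 2))

namespace PolyApprox

variable {K : Set ℂ}

/-- Off a compact set with connected complement, every point is joined to one at distance `1`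
without leaving the closed disc of radius `2`. -/
theorem exists_isPreconnected (hK : IsCompact K) (hKc : IsConnected Kᶜ) {c : ℂ} (hc : c ∉ K) :
    ∃ U : Set ℂ, ∃ b, IsPreconnected U ∧ Disjoint U K ∧ U ⊆ closedBall c 2 ∧ c ∈ U ∧ b ∈ U ∧
      ‖b - c‖ = 1 := by
  obtain ⟨R, hR0, hR⟩ : ∃ R > 0, ∀ z ∈ K, ‖z‖ ≤ R := exists_bound hK PolyApprox.id
  obtain ⟨A, hA⟩ : ∃ A : ℂ, ‖A‖ = R + 1 + ‖c‖ :=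
    ⟨((R + 1 + ‖c‖ : ℝ) : ℂ), by
      rw [Complex.norm_real, Real.norm_of_nonneg (by positivity)]⟩
  have hAK : A ∉ K := fun h => by
    have := hR A h
    linarith [norm_nonneg c]
  have hAc : 1 ≤ ‖A - c‖ := by
    linarith [norm_sub_norm_le A c]
  obtain ⟨γ, hγ⟩ := (hK.isClosed.isOpen_compl.isConnected_iff_isPathConnected.mp hKc).joinedIn
    c hc A hAK
  have hcont : Continuous fun t => ‖γ t - c‖ := by fun_prop
  have hcl : IsClosed {t | 1 ≤ ‖γ t - c‖} := isClosed_le continuous_const hcont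
  obtain ⟨t₀, ht₀, hmin⟩ := hcl.isCompact.exists_isLeast ⟨1, by simpa using hAc⟩
  have hlt : ∀ t < t₀, ‖γ t - c‖ < 1 := fun t ht => by
    by_contra! h
    exact (hmin h).not_gt ht
  have heq : ‖γ t₀ - c‖ = 1 := by
    refine le_antisymm ?_ ht₀
    obtain ⟨t, ht, ht1⟩ := intermediate_value_Icc (zero_le : 0 ≤ t₀) hcont.continuousOn
      (show (1 : ℝ) ∈ Set.Icc ‖γ 0 - c‖ ‖γ t₀ - c‖ from ⟨by simp, ht₀⟩)
    have := le_antisymm ht.2 (hmin (show 1 ≤ ‖γ t - c‖ from ht1.ge))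
    rw [← this]; exact ht1.le
  refine ⟨γ '' Set.Icc 0 t₀, γ t₀, isPreconnected_Icc.image _ γ.continuous.continuousOn, ?_, ?_,
    ⟨0, ⟨le_rfl, zero_le⟩, by simp⟩, ⟨t₀, ⟨zero_le, le_rfl⟩, rfl⟩, heq⟩
  · rw [Set.disjoint_left]
    rintro _ ⟨t, -, rfl⟩
    exact hγ t
  · rintro _ ⟨t, ht, rfl⟩
    rw [mem_closedBall_iff_norm]
    rcases ht.2.eq_or_lt with h | h
    · rw [h, heq]; norm_num
    · linarith [hlt t h]

theorem norm_kernel_sub_inv_le_near {Z S β κ g : ℂ} (hβ : ‖β‖ = 1) (hκ : ‖κ‖ ≤ 5 / 2)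
    (hS : S ^ 2 * Z = Z - β) (hg : g * β ^ 2 = 8 * (Z - β / 2 - Z * S)) (hZ : ‖Z‖ ≤ 4) :
    ‖g + κ * g ^ 2‖ ≤ 14516 := by
  have hs : ‖Z * S‖ ≤ 5 := by
    have h1 : (Z * S) ^ 2 = Z * (Z - β) := by rw [← hS]; ring
    have h2 : ‖Z * S‖ ^ 2 = ‖Z‖ * ‖Z - β‖ := by rw [← norm_pow, h1, norm_mul]
    have h3 : ‖Z - β‖ ≤ 5 := (norm_sub_le _ _).trans (by linarith)
    have h4 : ‖Z‖ * ‖Z - β‖ ≤ 4 * 5 := by gcongr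
    exact abs_le_of_sq_le_sq' (by linarith) (by norm_num) |>.2
  have hgn : ‖g‖ ≤ 76 := by
    have h1 : ‖g‖ = 8 * ‖Z - β / 2 - Z * S‖ := by
      have := congrArg norm hg
      simpa [hβ] using this
    have h2 : ‖β / 2‖ = 1 / 2 := by simp [hβ]
    have h3 := norm_sub_le (Z - β / 2) (Z * S)
    have h4 := norm_sub_le Z (β / 2)
    linarith
  calc ‖g + κ * g ^ 2‖ ≤ ‖g‖ + ‖κ‖ * ‖g‖ ^ 2 := by
        rw [← norm_pow, ← norm_mul]; exact norm_add_le _ _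
    _ ≤ 76 + 5 / 2 * 76 ^ 2 := by gcongr
    _ = 14516 := by norm_num

theorem norm_kernel_sub_inv_le_far {Z S β κ g : ℂ} (hβ : ‖β‖ = 1) (hκ : ‖κ + β / 2‖ ≤ 2)
    (hS : S ^ 2 * Z = Z - β) (hg : g * β ^ 2 = 8 * (Z - β / 2 - Z * S)) (hZ : 4 ≤ ‖Z‖)
    (hre : 0 < S.re) :
    ‖g + κ * g ^ 2 - (Z - β / 2 - κ)⁻¹‖ ≤ 60 / ‖Z‖ ^ 3 := by
  have hn : 0 < ‖Z‖ := by linarith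
  have hZ0 : Z ≠ 0 := norm_pos_iff.mp hn
  have hβ0 : β ≠ 0 := norm_pos_iff.mp (by rw [hβ]; norm_num)
  have hβ2 : ‖β / 2‖ = 1 / 2 := by simp [hβ]
  have hκ' : ‖κ‖ ≤ 5 / 2 := by
    have := norm_sub_le (κ + β / 2) (β / 2)
    rw [add_sub_cancel_right] at this
    linarith
  obtain ⟨u, hu⟩ : ∃ u, u = Z - β / 2 := ⟨_, rfl⟩
  have hun : ‖Z‖ / 2 ≤ ‖u‖ := by
    rw [hu]; linarith [norm_sub_norm_le Z (β / 2)]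
  have hu0 : u ≠ 0 := norm_pos_iff.mp (by linarith)
  have hukn : ‖Z‖ / 2 ≤ ‖u - κ‖ := by
    have := norm_sub_norm_le Z (κ + β / 2)
    rw [hu, show Z - β / 2 - κ = Z - (κ + β / 2) by ring]
    linarith
  have huk0 : u - κ ≠ 0 := norm_pos_iff.mp (by linarith)
  have hD : 1 / 2 ≤ ‖1 - β / 2 / Z + S‖ := by
    have h1 : ‖β / 2 / Z‖ ≤ 1 / 2 := by
      rw [norm_div, hβ2, div_le_iff₀ hn]; linarith
    have h2 := (abs_le.mp (Complex.abs_re_le_norm (β / 2 / Z))).2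
    have h3 := Complex.re_le_norm (1 - β / 2 / Z + S)
    rw [Complex.add_re, Complex.sub_re, Complex.one_re] at h3
    linarith
  have hD0 : 1 - β / 2 / Z + S ≠ 0 := norm_pos_iff.mp (by linarith)
  have hsum : Z * (1 - β / 2 / Z + S) = u + Z * S := by
    rw [hu]; field_simp
  have hg2 : g * (u + Z * S) = 2 := by
    have h1 : g * (u + Z * S) * β ^ 2 = 2 * β ^ 2 := by
      calc g * (u + Z * S) * β ^ 2 = g * β ^ 2 * (u + Z * S) := by ring
        _ = 8 * (u ^ 2 - Z * (S ^ 2 * Z)) := by rw [hg, ← hu]; ring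
        _ = 2 * β ^ 2 := by rw [hS, hu]; ring
    exact mul_right_cancel₀ (pow_ne_zero 2 hβ0) h1
  have hgn : ‖g‖ ≤ 4 / ‖Z‖ := by
    have h1 : ‖g‖ * (‖Z‖ * ‖1 - β / 2 / Z + S‖) = 2 := by
      rw [← norm_mul, ← norm_mul, hsum, hg2]; norm_num
    rw [le_div_iff₀ hn]
    nlinarith [mul_nonneg (norm_nonneg g) hn.le]
  have hdiff : g - u⁻¹ = β ^ 2 * g ^ 2 / (16 * u) := by
    have h1 : β ^ 2 * g ^ 2 = 8 * (g * u * 2) - 16 := by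
      have h2 : β ^ 2 * g ^ 2 = 8 * (g * (u - Z * S)) := by
        calc β ^ 2 * g ^ 2 = g * (g * β ^ 2) := by ring
          _ = _ := by rw [hg, hu]; ring
      linear_combination h2 - 8 * hg2
    rw [h1]
    field_simp
    ring
  have hdn : ‖g - u⁻¹‖ ≤ 2 / ‖Z‖ ^ 3 := by
    rw [hdiff, norm_div, norm_mul, norm_pow, norm_pow, norm_mul, hβ]
    calc 1 ^ 2 * ‖g‖ ^ 2 / (‖(16 : ℂ)‖ * ‖u‖) ≤ 1 ^ 2 * (4 / ‖Z‖) ^ 2 / (16 * (‖Z‖ / 2)) := by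
          have : ‖(16 : ℂ)‖ = 16 := by norm_num
          rw [this]
          gcongr
      _ = 2 / ‖Z‖ ^ 3 := by field_simp; norm_num
  have huinv : ‖u⁻¹‖ ≤ 2 / ‖Z‖ := by
    rw [norm_inv, inv_le_comm₀ (by linarith) (by positivity), inv_div]
    exact hun
  have hukinv : ‖(u - κ)⁻¹‖ ≤ 2 / ‖Z‖ := by
    rw [norm_inv, inv_le_comm₀ (by linarith) (by positivity), inv_div]
    exact hukn
  have hgu : ‖g + u⁻¹‖ ≤ 3 / 2 := by
    have : 4 / ‖Z‖ + 2 / ‖Z‖ ≤ 3 / 2 := by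
      rw [← add_div, div_le_iff₀ hn]; linarith
    exact (norm_add_le _ _).trans (by linarith)
  have hid : g + κ * g ^ 2 - (u - κ)⁻¹
      = (g - u⁻¹) + κ * (g - u⁻¹) * (g + u⁻¹) - κ ^ 2 * u⁻¹ ^ 2 * (u - κ)⁻¹ := by
    field_simp
    ring
  rw [← hu, hid]
  calc ‖(g - u⁻¹) + κ * (g - u⁻¹) * (g + u⁻¹) - κ ^ 2 * u⁻¹ ^ 2 * (u - κ)⁻¹‖
      ≤ ‖g - u⁻¹‖ + ‖κ‖ * ‖g - u⁻¹‖ * ‖g + u⁻¹‖ + ‖κ‖ ^ 2 * ‖u⁻¹‖ ^ 2 * ‖(u - κ)⁻¹‖ := by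
        simp only [← norm_mul, ← norm_pow]
        exact (norm_sub_le _ _).trans (add_le_add_left (norm_add_le _ _) _)
    _ ≤ 2 / ‖Z‖ ^ 3 + 5 / 2 * (2 / ‖Z‖ ^ 3) * (3 / 2)
        + (5 / 2) ^ 2 * (2 / ‖Z‖) ^ 2 * (2 / ‖Z‖) := by gcongr
    _ ≤ 60 / ‖Z‖ ^ 3 := by
        rw [← sub_nonneg]
        have : 60 / ‖Z‖ ^ 3 - (2 / ‖Z‖ ^ 3 + 5 / 2 * (2 / ‖Z‖ ^ 3) * (3 / 2)
          + (5 / 2) ^ 2 * (2 / ‖Z‖) ^ 2 * (2 / ‖Z‖)) = (1 / 2) / ‖Z‖ ^ 3 := by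
          field_simp; norm_num
        rw [this]; positivity

/-- Near any point off `K`, the Cauchy kernel is approximated on `K` by limits of polynomials that
depend affinely on the pole, with an error that is integrable in the pole. -/
theorem exists_kernel (hK : IsCompact K) (hKc : IsConnected Kᶜ) {c : ℂ} (hc : c ∉ K) :
    ∃ g : ℂ → ℂ, ∃ m : ℂ, PolyApprox K g ∧ ∀ z ∈ K, ∀ ζ ∈ ball c 2, z ≠ ζ →
      ‖g z + (ζ - m) * g z ^ 2 - (z - ζ)⁻¹‖ ≤ errorKernel ‖z - ζ‖ := by
  obtain ⟨U, b, hU, hUK, hUc, hcU, hbU, hb⟩ := exists_isPreconnected hK hKc hc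
  obtain ⟨S, hS, hSz⟩ := exists_sqrt_ratio hK hKc hU hUK hUc hcU hbU
  have hβ0 : b - c ≠ 0 := norm_pos_iff.mp (by rw [hb]; norm_num)
  refine ⟨fun z => 8 / (b - c) ^ 2 * ((z - c) - (b - c) / 2 - (z - c) * S z),
    c + (b - c) / 2, ?_, fun z hz ζ hζ hzζ => ?_⟩
  · have h1 := PolyApprox.id.sub hK (const (K := K) c)
    exact ((h1.sub hK (const _)).sub hK (h1.mul hK hS)).const_mul hK _
  have ht : 0 < ‖z - ζ‖ := norm_pos_iff.mpr (sub_ne_zero.mpr hzζ)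
  rw [mem_ball_iff_norm] at hζ
  have hSb : S z ^ 2 * (z - c) = (z - c) - (b - c) := by rw [(hSz z hz).1]; ring
  beta_reduce
  generalize hg : 8 / (b - c) ^ 2 * ((z - c) - (b - c) / 2 - (z - c) * S z) = g
  replace hg : g * (b - c) ^ 2 = 8 * ((z - c) - (b - c) / 2 - (z - c) * S z) := by
    rw [← hg]; field_simp
  have hκ2 : ‖(ζ - (c + (b - c) / 2)) + (b - c) / 2‖ ≤ 2 := by
    rw [show ζ - (c + (b - c) / 2) + (b - c) / 2 = ζ - c by ring]; exact hζ.le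
  have htri : ‖z - ζ‖ ≤ ‖z - c‖ + ‖ζ - c‖ := by
    rw [← sub_sub_sub_cancel_right z ζ c]; exact norm_sub_le _ _
  have htri' : ‖z - c‖ ≤ ‖z - ζ‖ + ‖ζ - c‖ := norm_sub_le_norm_sub_add_norm_sub _ _ _
  rcases le_total ‖z - c‖ 4 with h4 | h4
  · have hκ' : ‖ζ - (c + (b - c) / 2)‖ ≤ 5 / 2 := by
      have := norm_sub_le (ζ - (c + (b - c) / 2) + (b - c) / 2) ((b - c) / 2)
      rw [add_sub_cancel_right] at this
      have h2 : ‖(b - c) / 2‖ = 1 / 2 := by simp [hb]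
      linarith
    have h1 := norm_kernel_sub_inv_le_near hb hκ' hSb hg h4
    have ht6 : ‖z - ζ‖ ≤ 6 := by linarith
    refine (norm_sub_le _ _).trans ?_
    rw [norm_inv]
    calc _ ≤ 14516 + ‖z - ζ‖⁻¹ := by gcongr
      _ ≤ errorKernel ‖z - ζ‖ := by
        rw [errorKernel, le_div_iff₀ (by positivity)]
        have : (14516 + ‖z - ζ‖⁻¹) * (‖z - ζ‖ * (1 + ‖z - ζ‖ ^ 2))
          = (14516 * ‖z - ζ‖ + 1) * (1 + ‖z - ζ‖ ^ 2) := by field_simp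
        rw [this]
        calc _ ≤ (14516 * 6 + 1) * (1 + (6 : ℝ) ^ 2) := by gcongr
          _ ≤ 4000000 := by norm_num
  · have h1 := norm_kernel_sub_inv_le_far hb hκ2 hSb hg h4 ((hSz z hz).2 h4)
    rw [show z - c - (b - c) / 2 - (ζ - (c + (b - c) / 2)) = z - ζ by ring] at h1
    refine h1.trans ?_
    have h32 : ‖z - ζ‖ * (2 / 3) ≤ ‖z - c‖ := by linarith
    calc 60 / ‖z - c‖ ^ 3 ≤ 60 / (‖z - ζ‖ * (2 / 3)) ^ 3 := by gcongr
      _ ≤ errorKernel ‖z - ζ‖ := by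
        rw [errorKernel, div_le_div_iff₀ (by positivity) (by positivity)]
        have : 2 ≤ ‖z - ζ‖ := by linarith
        generalize ‖z - ζ‖ = t at *
        have h5 : 1 ≤ t ^ 2 := by nlinarith
        have h6 : t * 1 ≤ t * t ^ 2 := by gcongr
        nlinarith

end PolyApprox

section PlaneIntegrals

open MeasureTheory Set

theorem integrableOn_norm_sub_inv (a : ℂ) {s : Set ℂ} (hs : Bornology.IsBounded s) :
    IntegrableOn (fun ζ : ℂ => ‖ζ - a‖⁻¹) s := by
  obtain ⟨R, hR⟩ := hs.subset_ball a
  refine IntegrableOn.mono_set ?_ hR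
  have h0 : IntegrableOn (fun ζ : ℂ => ‖ζ‖⁻¹) (ball 0 R) := by
    rw [integrableOn_fun_norm_addHaar volume (f := fun y : ℝ => y⁻¹), Complex.finrank_real_complex]
    refine (integrableOn_const (C := (1 : ℝ)) (by simp)).congr_fun (fun y hy => ?_)
      measurableSet_Ioo
    simp [hy.1.ne']
  have := (measurePreserving_sub_right (volume : Measure ℂ) a).integrableOn_comp_preimage
    (MeasurableEquiv.subRight a).measurableEmbedding (f := fun ζ : ℂ => ‖ζ‖⁻¹) (s := ball 0 R)
  have hset : ball a R = (fun x => x - a) ⁻¹' ball 0 R := by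
    ext ζ
    rw [Set.mem_preimage, mem_ball_zero_iff, mem_ball_iff_norm]
  rw [hset]
  exact this.mpr h0

theorem integral_ball_eq_integral_circleMap {F : ℂ → ℂ} (hm : Measurable F)
    (hF : IntegrableOn F (ball 0 1)) :
    ∫ ζ in ball 0 1, F ζ = ∫ r in Ioo (0 : ℝ) 1, (r : ℂ) * ∫ θ in 0..2 * Real.pi,
      F (circleMap 0 r θ) := by
  have hpolar (p : ℝ × ℝ) : Complex.polarCoord.symm p = circleMap 0 p.1 p.2 := by
    rw [Complex.polarCoord_symm_apply, circleMap_zero, Complex.exp_mul_I, Complex.ofReal_cos,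
      Complex.ofReal_sin]
  set F' := (ball (0 : ℂ) 1).indicator F with hF'
  have hm' : Measurable F' := hm.indicator measurableSet_ball
  have hint : Integrable F' := (integrable_indicator_iff measurableSet_ball).mpr hF
  rw [← integral_indicator measurableSet_ball, ← Complex.integral_comp_polarCoord_symm,
    polarCoord_target]
  have hprod : IntegrableOn (fun p : ℝ × ℝ => p.1 • F' (Complex.polarCoord.symm p))
      (Ioi (0 : ℝ) ×ˢ Ioo (-Real.pi) Real.pi) := by
    refine ⟨?_, ?_⟩
    · have : Measurable fun p : ℝ × ℝ => p.1 • F' (Complex.polarCoord.symm p) := by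
        simp_rw [hpolar]
        have : Measurable fun p : ℝ × ℝ => circleMap 0 p.1 p.2 := by
          unfold circleMap; fun_prop
        fun_prop
      exact this.aestronglyMeasurable
    · have h1 := Complex.lintegral_comp_polarCoord_symm fun ζ => ‖F' ζ‖ₑ
      rw [polarCoord_target] at h1
      rw [HasFiniteIntegral]
      refine lt_of_eq_of_lt ?_ (h1.trans_lt hint.2)
      refine setLIntegral_congr_fun (measurableSet_Ioi.prod measurableSet_Ioo) fun p hp => ?_
      simp only [enorm_smul, smul_eq_mul]
      rw [Real.enorm_eq_ofReal (le_of_lt hp.1)]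
  rw [Measure.volume_eq_prod] at hprod ⊢
  rw [setIntegral_prod _ hprod]
  have hzero : ∀ r ∈ Ioi (0 : ℝ) \ Ioo 0 1,
      ∫ θ in Ioo (-Real.pi) Real.pi, r • F' (Complex.polarCoord.symm (r, θ)) = 0 := by
    intro r hr
    have h1 : 1 ≤ r := by
      by_contra! h
      exact hr.2 ⟨hr.1, h⟩
    refine (setIntegral_congr_fun measurableSet_Ioo (g := fun _ => (0 : ℂ)) fun θ _ => ?_).trans
      (by simp)
    have : Complex.polarCoord.symm (r, θ) ∉ ball (0 : ℂ) 1 := by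
      rw [mem_ball_zero_iff, Complex.norm_polarCoord_symm, not_lt]
      exact h1.trans (le_abs_self r)
    simp only [hF']
    rw [indicator_of_notMem this, smul_zero]
  rw [setIntegral_eq_of_subset_of_forall_sdiff_eq_zero measurableSet_Ioi
    (fun r hr => hr.1) hzero]
  refine setIntegral_congr_fun measurableSet_Ioo fun r hr => ?_
  have hper : Function.Periodic (fun θ => F (circleMap 0 r θ)) (2 * Real.pi) :=
    fun θ => by simp only [periodic_circleMap 0 r θ]
  have hshift := hper.intervalIntegral_add_eq (-Real.pi) 0
  rw [zero_add, show -Real.pi + 2 * Real.pi = Real.pi by ring] at hshift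
  rw [← hshift, intervalIntegral.integral_of_le (by linarith [Real.pi_pos]),
    integral_Ioc_eq_integral_Ioo, integral_smul, Complex.real_smul]
  congr 1
  refine setIntegral_congr_fun measurableSet_Ioo fun θ _ => ?_
  simp only [hpolar]
  refine indicator_of_mem ?_ F
  rw [mem_ball_zero_iff, norm_circleMap_zero, abs_of_pos hr.1]
  exact hr.2

theorem integral_circleMap_mul_eq (g : ℂ → ℂ) (r : ℝ) :
    ∫ θ in 0..2 * Real.pi, circleMap 0 r θ * g (circleMap 0 r θ)
      = -Complex.I * ∮ ξ in C(0, r), g ξ := by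
  rw [circleIntegral, ← intervalIntegral.integral_const_mul]
  refine intervalIntegral.integral_congr fun θ _ => ?_
  simp only [deriv_circleMap, smul_eq_mul]
  linear_combination (circleMap 0 r θ * g (circleMap 0 r θ)) * Complex.I_sq

/-- The moment `∫ ξ f(ζ + ξ)` over the unit disc vanishes when `f` is holomorphic on the
disc about `ζ`. -/
theorem integral_ball_mul_eq_zero {f : ℂ → ℂ} (hf : Continuous f) {ζ : ℂ}
    (hd : DifferentiableOn ℂ f (ball ζ 1)) : ∫ ξ in ball 0 1, ξ * f (ζ + ξ) = 0 := by
  have hc : Continuous fun ξ => ξ * f (ζ + ξ) := by fun_prop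
  rw [integral_ball_eq_integral_circleMap hc.measurable
    ((hc.continuousOn.integrableOn_compact (isCompact_closedBall 0 1)).mono_set
      ball_subset_closedBall)]
  refine (setIntegral_congr_fun measurableSet_Ioo (g := fun _ => (0 : ℂ)) fun r hr => ?_).trans
    (by simp)
  simp only
  rw [integral_circleMap_mul_eq fun ξ => f (ζ + ξ)]
  have : ∮ ξ in C(0, r), f (ζ + ξ) = 0 := by
    refine Complex.circleIntegral_eq_zero_of_differentiable_on_off_countable hr.1.le
      countable_empty (by fun_prop) fun z hz => ?_
    have hz' : ζ + z ∈ ball ζ 1 := by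
      have := mem_ball_zero_iff.mp hz.1
      rw [mem_ball_iff_norm, add_sub_cancel_left]
      exact this.trans hr.2
    exact (hd.differentiableAt (isOpen_ball.mem_nhds hz')).comp z (by fun_prop)
  rw [this]; simp

/-- The radial bump `max 0 (1 - ‖w‖²)`. -/
def radialBump (w : ℂ) : ℝ := max 0 (1 - ‖w‖ ^ 2)

theorem continuous_radialBump : Continuous radialBump := by
  unfold radialBump; fun_prop

theorem radialBump_nonneg (w : ℂ) : 0 ≤ radialBump w := le_max_left _ _

theorem radialBump_eq_zero {w : ℂ} (h : 1 ≤ ‖w‖) : radialBump w = 0 :=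
  max_eq_left (by nlinarith)

theorem integrableOn_ball_div_add (w : ℂ) : IntegrableOn (fun ξ => ξ * (w + ξ)⁻¹) (ball 0 1) := by
  refine Integrable.mono' (integrableOn_norm_sub_inv (-w) (isBounded_ball (x := 0) (r := 1)))
    (by fun_prop) ?_
  filter_upwards [ae_restrict_mem measurableSet_ball] with ξ hξ
  rw [mem_ball_zero_iff] at hξ
  rw [norm_mul, norm_inv, sub_neg_eq_add, add_comm ξ w]
  exact mul_le_of_le_one_left (by positivity) hξ.le

theorem integral_ball_div_add (w : ℂ) :
    ∫ ξ in ball 0 1, ξ * (w + ξ)⁻¹ = ((Real.pi * radialBump w : ℝ) : ℂ) := by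
  rw [integral_ball_eq_integral_circleMap (by fun_prop) (integrableOn_ball_div_add w)]
  have hcircle : ∀ r ∈ Ioo (0 : ℝ) 1, r ≠ ‖w‖ → (r : ℂ) * ∫ θ in 0..2 * Real.pi,
      (circleMap 0 r θ * (w + circleMap 0 r θ)⁻¹)
      = (Ioi ‖w‖).indicator (fun r : ℝ => ((2 * Real.pi * r : ℝ) : ℂ)) r := by
    intro r hr hne
    rw [integral_circleMap_mul_eq fun ξ => (w + ξ)⁻¹]
    rcases lt_or_gt_of_ne hne with h | h
    · have : ∮ ξ in C(0, r), (w + ξ)⁻¹ = 0 := by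
        have h0 : ∀ z ∈ closedBall (0 : ℂ) r, w + z ≠ 0 := fun z hz h0 => by
          rw [mem_closedBall_zero_iff] at hz
          rw [eq_neg_of_add_eq_zero_left h0, norm_neg] at h
          linarith
        refine Complex.circleIntegral_eq_zero_of_differentiable_on_off_countable hr.1.le
          countable_empty (ContinuousOn.inv₀ (by fun_prop) h0) fun z hz => ?_
        exact (DifferentiableAt.inv (by fun_prop) (h0 z (ball_subset_closedBall hz.1)))
      rw [this, indicator_of_notMem (by simpa using h.le)]
      simp
    · have : ∮ ξ in C(0, r), (w + ξ)⁻¹ = 2 * Real.pi * Complex.I := by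
        rw [← circleIntegral.integral_sub_inv_of_mem_ball (c := 0) (w := -w) (R := r)
          (by simpa using h)]
        simp [add_comm]
      rw [this, indicator_of_mem (by simpa using h)]
      push_cast
      linear_combination (-2 * Real.pi * r) * Complex.I_sq
  have hae : ∀ᵐ r : ℝ, r ≠ ‖w‖ := by simp [ae_iff]
  rw [setIntegral_congr_ae measurableSet_Ioo (hae.mono fun r hr hr' => hcircle r hr' hr),
    setIntegral_indicator measurableSet_Ioi, integral_complex_ofReal]
  congr 1
  have hset : Ioo (0 : ℝ) 1 ∩ Ioi ‖w‖ = Ioo ‖w‖ 1 := by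
    ext r
    simp only [mem_inter_iff, Set.mem_Ioo, Set.mem_Ioi]
    exact ⟨fun h => ⟨h.2, h.1.2⟩, fun h => ⟨⟨(norm_nonneg w).trans_lt h.1, h.2⟩, h.1⟩⟩
  rw [hset]
  rcases le_or_gt 1 ‖w‖ with h | h
  · rw [Ioo_eq_empty (not_lt.mpr h), radialBump_eq_zero h]; simp
  · rw [← integral_Ioc_eq_integral_Ioo, ← intervalIntegral.integral_of_le h.le,
      intervalIntegral.integral_const_mul, integral_id, radialBump,
      max_eq_right (by nlinarith [norm_nonneg w])]
    ring

theorem hasCompactSupport_radialBump : HasCompactSupport radialBump := by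
  refine HasCompactSupport.intro (isCompact_closedBall 0 1) fun w hw => radialBump_eq_zero ?_
  rw [mem_closedBall_zero_iff, not_le] at hw
  exact hw.le

theorem integrable_radialBump : Integrable radialBump :=
  continuous_radialBump.integrable_of_hasCompactSupport hasCompactSupport_radialBump

theorem integral_radialBump : ∫ w, radialBump w = Real.pi / 2 := by
  have h := integral_fun_norm_addHaar (volume : Measure ℂ) fun y : ℝ => max 0 (1 - y ^ 2)
  have hvol : (volume : Measure ℂ).real (ball 0 1) = Real.pi := by
    simp [measureReal_def, Complex.volume_ball]
  have hint : ∫ y in Ioi (0 : ℝ), y ^ (2 - 1) • max 0 (1 - y ^ 2) = 1 / 4 := by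
    have hzero : ∀ y ∈ Ioi (0 : ℝ) \ Ioc 0 1, y ^ (2 - 1) • max 0 (1 - y ^ 2) = 0 := by
      intro y hy
      have h1 : 1 < y := by
        by_contra! h
        exact hy.2 ⟨hy.1, h⟩
      rw [max_eq_left (by nlinarith), smul_zero]
    rw [setIntegral_eq_of_subset_of_forall_sdiff_eq_zero measurableSet_Ioi
      (fun r hr => hr.1) hzero]
    rw [setIntegral_congr_fun (g := fun y : ℝ => y - y ^ 3) measurableSet_Ioc fun y hy => ?_,
      ← intervalIntegral.integral_of_le zero_le_one, intervalIntegral.integral_sub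
        (by simp) (by simp), integral_id, integral_pow]
    · norm_num
    · simp only
      rw [max_eq_right (by nlinarith [hy.1, hy.2]), smul_eq_mul]
      ring
  rw [Complex.finrank_real_complex, hvol, hint] at h
  simp only [radialBump]
  rw [h]
  simp only [smul_eq_mul, nsmul_eq_mul]
  push_cast
  ring

theorem integrable_errorKernel : Integrable fun w : ℂ => errorKernel ‖w‖ := by
  rw [integrable_fun_norm_addHaar volume, Complex.finrank_real_complex]
  refine ((integrable_inv_one_add_sq.const_mul 4000000).integrableOn (s := Ioi 0)).congr_fun
    (fun y hy => ?_) measurableSet_Ioi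
  have : y ≠ 0 := ne_of_gt hy
  simp only [errorKernel, smul_eq_mul]
  field_simp
  simp

/-- The moment `∫ ξ f(ζ + ξ)` over the unit disc, a multiple of `∂̄` of a smoothing of `f`. -/
def discMoment (f : ℂ → ℂ) (ζ : ℂ) : ℂ := ∫ ξ in ball 0 1, ξ * f (ζ + ξ)

theorem measurable_discMoment {f : ℂ → ℂ} (hf : Continuous f) : Measurable (discMoment f) := by
  have : StronglyMeasurable (Function.uncurry fun ζ ξ : ℂ => ξ * f (ζ + ξ)) := by
    have : Continuous (Function.uncurry fun ζ ξ : ℂ => ξ * f (ζ + ξ)) := by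
      unfold Function.uncurry; fun_prop
    exact this.stronglyMeasurable
  exact this.integral_prod_right.measurable

theorem norm_discMoment_le {f : ℂ → ℂ} (hf : Continuous f) {η : ℝ}
    (hη : ∀ x y, ‖x - y‖ ≤ 1 → ‖f x - f y‖ ≤ η) (ζ : ℂ) : ‖discMoment f ζ‖ ≤ η * Real.pi := by
  have hint : ∀ g : ℂ → ℂ, Continuous g → IntegrableOn g (ball 0 1) := fun g hg =>
    (hg.continuousOn.integrableOn_compact (isCompact_closedBall 0 1)).mono_set
      ball_subset_closedBall
  have hconst := integral_ball_mul_eq_zero (f := fun _ => f ζ) continuous_const (ζ := 0)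
    (differentiableOn_const _)
  have h : discMoment f ζ = ∫ ξ in ball 0 1, ξ * (f (ζ + ξ) - f ζ) := by
    simp_rw [mul_sub]
    rw [integral_sub (hint _ (by fun_prop)) (hint _ (by fun_prop)), hconst, sub_zero, discMoment]
  have hvol : (volume : Measure ℂ).real (ball 0 1) = Real.pi := by
    simp [measureReal_def, Complex.volume_ball]
  rw [h, ← hvol]
  refine norm_setIntegral_le_of_norm_le_const measure_ball_lt_top fun ξ hξ => ?_
  rw [mem_ball_zero_iff] at hξ
  have := hη (ζ + ξ) ζ (by simpa using hξ.le)
  rw [norm_mul]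
  calc ‖ξ‖ * ‖f (ζ + ξ) - f ζ‖ ≤ 1 * η := by gcongr
    _ = η := one_mul η

theorem discMoment_eq_zero_of_support {f : ℂ → ℂ} {R : ℝ} (hR : ∀ z, R ≤ ‖z‖ → f z = 0) {ζ : ℂ}
    (hζ : R + 1 ≤ ‖ζ‖) : discMoment f ζ = 0 := by
  refine (setIntegral_congr_fun measurableSet_ball (g := fun _ => (0 : ℂ)) fun ξ hξ => ?_).trans
    (by simp)
  rw [mem_ball_zero_iff] at hξ
  have : ‖ζ‖ - ‖ξ‖ ≤ ‖ζ + ξ‖ := by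
    have := norm_sub_le (ζ + ξ) ξ
    rw [add_sub_cancel_right] at this
    linarith
  simp [hR (ζ + ξ) (by linarith)]

theorem integral_discMoment_mul_inv {f : ℂ → ℂ} (hf : Continuous f) {R : ℝ}
    (hR : ∀ z, R ≤ ‖z‖ → f z = 0) (z : ℂ) :
    ∫ ζ, discMoment f ζ * (z - ζ)⁻¹ = ∫ v, f v * ((Real.pi * radialBump (z - v) : ℝ) : ℂ) := by
  obtain ⟨M, hM⟩ := (isCompact_closedBall (0 : ℂ) R).exists_bound_of_continuousOn hf.continuousOn
  have hM' : ∀ v, ‖f v‖ ≤ (closedBall (0 : ℂ) R).indicator (fun _ => M) v := fun v => by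
    by_cases hv : v ∈ closedBall (0 : ℂ) R
    · rw [indicator_of_mem hv]; exact hM v hv
    · rw [indicator_of_notMem hv]
      rw [mem_closedBall_zero_iff, not_le] at hv
      rw [hR v hv.le, norm_zero]
  let k : ℂ → ℂ := (ball (0 : ℂ) 1).indicator fun ξ => ξ
  have hk : Measurable k := measurable_id.indicator measurableSet_ball
  have hinner (ζ : ℂ) : discMoment f ζ * (z - ζ)⁻¹ = ∫ v, k (v - ζ) * f v * (z - ζ)⁻¹ := by
    rw [integral_mul_const, discMoment, ← integral_indicator measurableSet_ball,
      ← integral_sub_right_eq_self _ ζ]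
    congr 2
    ext v
    by_cases hv : v - ζ ∈ ball (0 : ℂ) 1
    · simp only [k, indicator_of_mem hv, add_sub_cancel]
    · simp only [k, indicator_of_notMem hv, zero_mul]
  have hprod : Integrable (Function.uncurry fun ζ v : ℂ => k (v - ζ) * f v * (z - ζ)⁻¹)
      (volume.prod volume) := by
    have h1 : Integrable ((ball (0 : ℂ) (R + 1)).indicator fun ζ => ‖ζ - z‖⁻¹) :=
      (integrable_indicator_iff measurableSet_ball).mpr (integrableOn_norm_sub_inv z isBounded_ball)
    have h2 : Integrable ((closedBall (0 : ℂ) R).indicator fun _ => M) :=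
      (integrable_indicator_iff measurableSet_closedBall).mpr
        (integrableOn_const measure_closedBall_lt_top.ne)
    refine (h1.mul_prod h2).mono' ?_ (.of_forall fun ⟨ζ, v⟩ => ?_)
    · have hfm := hf.measurable
      have : Measurable (Function.uncurry fun ζ v : ℂ => k (v - ζ) * f v * (z - ζ)⁻¹) := by
        unfold Function.uncurry; fun_prop
      exact this.aestronglyMeasurable
    · have hnn : 0 ≤ (ball (0 : ℂ) (R + 1)).indicator (fun ζ => ‖ζ - z‖⁻¹) ζ :=
        indicator_nonneg (fun _ _ => by positivity) ζ
      simp only [Function.uncurry_apply_pair]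
      by_cases hv : v - ζ ∈ ball (0 : ℂ) 1
      · by_cases hvR : R ≤ ‖v‖
        · rw [hR v hvR, mul_zero, zero_mul, norm_zero]
          exact mul_nonneg hnn ((norm_nonneg _).trans (hM' v))
        · have hζ : ζ ∈ ball (0 : ℂ) (R + 1) := by
            rw [mem_ball_zero_iff] at hv ⊢
            have := norm_sub_le v (v - ζ)
            rw [sub_sub_cancel] at this
            linarith
          simp only [k, indicator_of_mem hv, norm_mul, norm_inv]
          rw [indicator_of_mem hζ, norm_sub_rev z ζ]
          rw [mem_ball_zero_iff] at hv
          calc ‖v - ζ‖ * ‖f v‖ * ‖ζ - z‖⁻¹ ≤ 1 * ‖f v‖ * ‖ζ - z‖⁻¹ := by gcongr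
            _ = ‖ζ - z‖⁻¹ * ‖f v‖ := by ring
            _ ≤ _ := by gcongr; exact hM' v
      · simp only [k, indicator_of_notMem hv, zero_mul, norm_zero]
        exact mul_nonneg hnn ((norm_nonneg _).trans (hM' v))
  simp_rw [hinner]
  rw [integral_integral_swap hprod]
  congr 1
  ext v
  rw [← integral_ball_div_add, ← integral_indicator measurableSet_ball, ← integral_const_mul,
    ← integral_sub_left_eq_self _ volume v]
  congr 1
  ext ξ
  by_cases hv : ξ ∈ ball (0 : ℂ) 1
  · simp only [k, sub_sub_cancel, indicator_of_mem hv]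
    rw [show z - (v - ξ) = z - v + ξ by ring]
    ring
  · simp only [k, sub_sub_cancel, indicator_of_notMem hv, zero_mul, mul_zero]

/-- The Cauchy transform of `discMoment f` is a smoothing of `f`, hence close to `f`. -/
theorem norm_integral_discMoment_sub_le {f : ℂ → ℂ} (hf : Continuous f) {R : ℝ}
    (hR : ∀ z, R ≤ ‖z‖ → f z = 0) {η : ℝ} (hη : ∀ x y, ‖x - y‖ ≤ 1 → ‖f x - f y‖ ≤ η) (z : ℂ) :
    ‖(2 / Real.pi ^ 2 : ℂ) * (∫ ζ, discMoment f ζ * (z - ζ)⁻¹) - f z‖ ≤ η := by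
  have hpi : (Real.pi : ℂ) ≠ 0 := by exact_mod_cast Real.pi_ne_zero
  have hb : Integrable fun v => radialBump (z - v) := integrable_radialBump.comp_sub_left z
  have hbC : Integrable fun v => ((Real.pi * radialBump (z - v) : ℝ) : ℂ) :=
    (hb.const_mul Real.pi).ofReal
  have hmass : ∫ v, radialBump (z - v) = Real.pi / 2 := by
    rw [integral_sub_left_eq_self (fun w => radialBump w) volume z, integral_radialBump]
  have hfz : f z = (2 / Real.pi ^ 2 : ℂ) * ∫ v, f z * ((Real.pi * radialBump (z - v) : ℝ) : ℂ) := by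
    rw [integral_const_mul, integral_complex_ofReal, integral_const_mul, hmass]
    push_cast
    field_simp
  have hfint : Integrable fun v => f v * ((Real.pi * radialBump (z - v) : ℝ) : ℂ) := by
    have hfs : HasCompactSupport f := HasCompactSupport.intro (isCompact_closedBall 0 R)
      fun v hv => hR v (by rw [mem_closedBall_zero_iff, not_le] at hv; exact hv.le)
    refine Continuous.integrable_of_hasCompactSupport ?_ hfs.mul_right
    have := continuous_radialBump
    fun_prop
  rw [integral_discMoment_mul_inv hf hR, hfz, ← mul_sub,
    ← integral_sub hfint (hbC.const_mul (f z))]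
  have hle : ‖∫ v, (f v * ((Real.pi * radialBump (z - v) : ℝ) : ℂ)
      - f z * ((Real.pi * radialBump (z - v) : ℝ) : ℂ))‖
      ≤ ∫ v, η * (Real.pi * radialBump (z - v)) := by
    refine norm_integral_le_of_norm_le ((hb.const_mul Real.pi).const_mul η)
      (.of_forall fun v => ?_)
    rw [← sub_mul, norm_mul, Complex.norm_real, Real.norm_of_nonneg
      (mul_nonneg Real.pi_pos.le (radialBump_nonneg _))]
    rcases le_or_gt 1 ‖z - v‖ with h | h
    · rw [radialBump_eq_zero h]; simp
    · gcongr
      · exact mul_nonneg Real.pi_pos.le (radialBump_nonneg _)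
      · exact hη v z (by rw [norm_sub_rev]; exact h.le)
  rw [integral_const_mul, integral_const_mul, hmass] at hle
  rw [norm_mul, norm_div, norm_pow, Complex.norm_real, Real.norm_of_nonneg Real.pi_pos.le,
    Complex.norm_ofNat]
  calc _ ≤ 2 / Real.pi ^ 2 * (η * (Real.pi * (Real.pi / 2))) := by gcongr
    _ = η := by field_simp [Real.pi_ne_zero]

theorem errorKernel_nonneg {t : ℝ} (ht : 0 ≤ t) : 0 ≤ errorKernel t := by
  unfold errorKernel; positivity

theorem integrable_errorKernel_sub (z : ℂ) : Integrable fun ζ => errorKernel ‖z - ζ‖ :=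
  integrable_errorKernel.comp_sub_left z

theorem integrableOn_mul_sub_inv {G : ℂ → ℂ} (hG : Measurable G) {N : ℝ} (hN : ∀ ζ, ‖G ζ‖ ≤ N)
    {A : Set ℂ} (hA : Bornology.IsBounded A) (z : ℂ) :
    IntegrableOn (fun ζ => G ζ * (z - ζ)⁻¹) A := by
  refine ((integrableOn_norm_sub_inv z hA).const_mul N).mono' (by fun_prop) (.of_forall fun ζ => ?_)
  rw [norm_mul, norm_inv, norm_sub_rev]
  gcongr
  exact hN ζ

theorem PolyApprox.exists_setIntegral_of_subset_ball {K : Set ℂ} (hK : IsCompact K)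
    (hKc : IsConnected Kᶜ) {G : ℂ → ℂ} (hG : Measurable G) {N : ℝ} (hN : ∀ ζ, ‖G ζ‖ ≤ N)
    {c : ℂ} (hc : c ∉ K) {A : Set ℂ} (hAc : A ⊆ ball c 2) (hA : MeasurableSet A) :
    ∃ F, PolyApprox K F ∧ ∀ z ∈ K,
      ‖F z - ∫ ζ in A, G ζ * (z - ζ)⁻¹‖ ≤ N * ∫ ζ in A, errorKernel ‖z - ζ‖ := by
  obtain ⟨g, m, hg, hgk⟩ := exists_kernel hK hKc hc
  have hAb : Bornology.IsBounded A := isBounded_ball.subset hAc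
  have hGint : IntegrableOn G A :=
    Measure.integrableOn_of_bounded hAb.measure_lt_top.ne hG.aestronglyMeasurable
      (.of_forall hN)
  have hGm : IntegrableOn (fun ζ => G ζ * (ζ - m)) A := by
    refine Measure.integrableOn_of_bounded (M := N * (2 + ‖c - m‖)) hAb.measure_lt_top.ne
      (by fun_prop) ((ae_restrict_iff' hA).mpr (.of_forall fun ζ hζ => ?_))
    have h1 := hAc hζ
    rw [mem_ball_iff_norm] at h1
    have h2 : ‖ζ - m‖ ≤ 2 + ‖c - m‖ := by
      calc ‖ζ - m‖ ≤ ‖ζ - c‖ + ‖c - m‖ := norm_sub_le_norm_sub_add_norm_sub _ _ _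
        _ ≤ _ := by gcongr
    rw [norm_mul]
    exact mul_le_mul (hN ζ) h2 (norm_nonneg _) ((norm_nonneg _).trans (hN ζ))
  refine ⟨fun z => (∫ ζ in A, G ζ) * g z + (∫ ζ in A, G ζ * (ζ - m)) * g z ^ 2,
    (hg.const_mul hK _).add ((hg.pow hK 2).const_mul hK _), fun z hz => ?_⟩
  have hsum : IntegrableOn (fun ζ => G ζ * g z + G ζ * (ζ - m) * g z ^ 2) A :=
    (hGint.mul_const _).add (hGm.mul_const _)
  dsimp only
  rw [← integral_mul_const, ← integral_mul_const,
    ← integral_add (hGint.mul_const _) (hGm.mul_const _),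
    ← integral_sub hsum (integrableOn_mul_sub_inv hG hN hAb z), ← integral_const_mul]
  refine norm_integral_le_of_norm_le ((integrable_errorKernel_sub z).integrableOn.const_mul N) ?_
  rw [ae_restrict_iff' hA]
  filter_upwards [compl_mem_ae_iff.mpr (measure_singleton (μ := volume) z)] with ζ hζ hζA
  have hne : z ≠ ζ := fun h => hζ (by simp [h])
  rw [show G ζ * g z + G ζ * (ζ - m) * g z ^ 2 - G ζ * (z - ζ)⁻¹
    = G ζ * (g z + (ζ - m) * g z ^ 2 - (z - ζ)⁻¹) by ring, norm_mul]
  exact mul_le_mul (hN ζ) (hgk z hz ζ (hAc hζA) hne) (norm_nonneg _)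
    ((norm_nonneg _).trans (hN ζ))

theorem PolyApprox.exists_setIntegral {K : Set ℂ} (hK : IsCompact K)
    (hKc : IsConnected Kᶜ) {G : ℂ → ℂ} (hG : Measurable G) {N : ℝ} (hN : ∀ ζ, ‖G ζ‖ ≤ N)
    (t : Finset ℂ) (ht : ∀ c ∈ t, c ∉ K) {A : Set ℂ} (hAt : A ⊆ ⋃ c ∈ t, ball c 2)
    (hA : MeasurableSet A) :
    ∃ F, PolyApprox K F ∧ ∀ z ∈ K,
      ‖F z - ∫ ζ in A, G ζ * (z - ζ)⁻¹‖ ≤ N * ∫ ζ in A, errorKernel ‖z - ζ‖ := by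
  classical
  induction t using Finset.induction_on generalizing A with
  | empty =>
    have : A = ∅ := by simpa using hAt
    exact ⟨fun _ => 0, const 0, by simp [this]⟩
  | insert c t hct ih =>
    rw [Finset.set_biUnion_insert] at hAt
    obtain ⟨F₁, hF₁, hF₁'⟩ := exists_setIntegral_of_subset_ball hK hKc hG hN
      (ht c (Finset.mem_insert_self c t)) (A := A ∩ ball c 2) Set.inter_subset_right
      (hA.inter measurableSet_ball)
    obtain ⟨F₂, hF₂, hF₂'⟩ := ih (fun d hd => ht d (Finset.mem_insert_of_mem hd))
      (A := A \ ball c 2) (by rwa [Set.sdiff_subset_iff]) (hA.diff measurableSet_ball)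
    have hAb : Bornology.IsBounded A := by
      refine Bornology.IsBounded.subset ?_ hAt
      exact isBounded_ball.union
        ((Bornology.isBounded_biUnion_finset t).mpr fun _ _ => isBounded_ball)
    refine ⟨fun z => F₁ z + F₂ z, hF₁.add hF₂, fun z hz => ?_⟩
    rw [← integral_inter_add_sdiff measurableSet_ball (integrableOn_mul_sub_inv hG hN hAb z),
      ← integral_inter_add_sdiff (s := A) (t := ball c 2) measurableSet_ball
        (integrable_errorKernel_sub z).integrableOn, add_sub_add_comm, mul_add]
    exact (norm_add_le _ _).trans (add_le_add (hF₁' z hz) (hF₂' z hz))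

/-- If `f` oscillates by at most `η` at unit scale, then it is approximated on `K` by polynomials
up to a universal multiple of `η`. -/
theorem PolyApprox.exists_norm_sub_le {K : Set ℂ} (hK : IsCompact K) (hKc : IsConnected Kᶜ)
    {f : ℂ → ℂ} (hf : Continuous f) {R : ℝ} (hR : ∀ z, R ≤ ‖z‖ → f z = 0)
    (hd : DifferentiableOn ℂ f (interior K)) {η : ℝ}
    (hη : ∀ x y, ‖x - y‖ ≤ 1 → ‖f x - f y‖ ≤ η) :
    ∃ F, PolyApprox K F ∧ ∀ z ∈ K,
      ‖F z - f z‖ ≤ (1 + 2 / Real.pi * ∫ w : ℂ, errorKernel ‖w‖) * η := by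
  set G := discMoment f
  have hG : Measurable G := measurable_discMoment hf
  have hN := norm_discMoment_le hf hη
  have hη0 : 0 ≤ η := (norm_nonneg _).trans (hη 0 0 (by simp))
  set A : Set ℂ := {ζ | G ζ ≠ 0}
  have hA : MeasurableSet A := (hG (measurableSet_singleton 0)).compl
  have hAb : A ⊆ ball 0 (R + 1) := fun ζ hζ => by
    rw [mem_ball_zero_iff]
    by_contra! h
    exact hζ (discMoment_eq_zero_of_support hR h)
  have hcen : ∀ ζ ∈ A, ∃ c ∉ K, ‖c - ζ‖ < 1 := fun ζ hζ => by
    by_contra! h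
    refine hζ (integral_ball_mul_eq_zero hf (hd.mono ?_))
    refine interior_maximal (fun c hc => ?_) isOpen_ball
    by_contra hcK
    rw [mem_ball_iff_norm] at hc
    exact hc.not_ge (h c hcK)
  choose! c hcK hcd using hcen
  have htb : TotallyBounded A :=
    (isCompact_closedBall _ _).totallyBounded.subset (hAb.trans ball_subset_closedBall)
  obtain ⟨s, hsA, hsf, hs⟩ := finite_approx_of_totallyBounded htb 1 one_pos
  classical
  obtain ⟨F, hF, hF'⟩ := exists_setIntegral hK hKc hG hN (hsf.toFinset.image c)
    (by simpa using fun ζ hζ => hcK ζ (hsA hζ)) (A := A) (fun ζ hζ => by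
      obtain ⟨ξ, hξ, hζξ⟩ := Set.mem_iUnion₂.mp (hs hζ)
      refine Set.mem_iUnion₂.mpr ⟨c ξ, by simpa using ⟨ξ, hξ, rfl⟩, ?_⟩
      rw [mem_ball_iff_norm] at hζξ ⊢
      have := hcd ξ (hsA hξ)
      rw [norm_sub_rev] at this
      calc ‖ζ - c ξ‖ ≤ ‖ζ - ξ‖ + ‖ξ - c ξ‖ := norm_sub_le_norm_sub_add_norm_sub _ _ _
        _ < 2 := by linarith) hA
  refine ⟨fun z => (2 / Real.pi ^ 2 : ℂ) * F z, hF.const_mul hK _, fun z hz => ?_⟩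
  have h1 := norm_integral_discMoment_sub_le hf hR hη z
  have h2 := hF' z hz
  rw [setIntegral_eq_integral_of_forall_compl_eq_zero fun ζ hζ => by
    rw [show G ζ = 0 by simpa [A] using hζ, zero_mul]] at h2
  have h3 : ∫ ζ in A, errorKernel ‖z - ζ‖ ≤ ∫ w : ℂ, errorKernel ‖w‖ := by
    rw [← integral_sub_left_eq_self (fun w : ℂ => errorKernel ‖w‖) volume z]
    exact setIntegral_le_integral (integrable_errorKernel_sub z)
      (.of_forall fun ζ => errorKernel_nonneg (norm_nonneg _))
  have hpi : ‖(2 / Real.pi ^ 2 : ℂ)‖ = 2 / Real.pi ^ 2 := by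
    rw [norm_div, norm_pow, Complex.norm_real, Real.norm_of_nonneg Real.pi_pos.le,
      Complex.norm_ofNat]
  calc ‖(2 / Real.pi ^ 2 : ℂ) * F z - f z‖
      = ‖(2 / Real.pi ^ 2 : ℂ) * (F z - ∫ ζ, G ζ * (z - ζ)⁻¹)
        + ((2 / Real.pi ^ 2 : ℂ) * (∫ ζ, G ζ * (z - ζ)⁻¹) - f z)‖ := by ring_nf
    _ ≤ 2 / Real.pi ^ 2 * (η * Real.pi * ∫ w : ℂ, errorKernel ‖w‖) + η := by
      refine (norm_add_le _ _).trans (add_le_add ?_ h1)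
      rw [norm_mul, hpi]
      gcongr
      exact h2.trans (by gcongr)
    _ = _ := by field_simp; ring

end PlaneIntegrals

theorem PolyApprox.comp_const_mul {K : Set ℂ} {f : ℂ → ℂ} {c : ℂ}
    (hf : PolyApprox ((fun w => c⁻¹ * w) ⁻¹' K) f) (hc : c ≠ 0) :
    PolyApprox K fun z => f (c * z) := by
  intro ε hε
  obtain ⟨P, hP⟩ := hf ε hε
  refine ⟨P.comp (Polynomial.C c * Polynomial.X), fun z hz => ?_⟩
  simpa using hP (c * z) (by simpa [Set.mem_preimage, inv_mul_cancel_left₀ hc] using hz)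

theorem exists_continuous_eqOn_of_isCompact {K : Set ℂ} (hK : IsCompact K) {h : ℂ → ℂ}
    (hh : ContinuousOn h K) :
    ∃ f : ℂ → ℂ, Continuous f ∧ Set.EqOn f h K ∧ ∃ R, ∀ z, R ≤ ‖z‖ → f z = 0 := by
  obtain ⟨g, hg⟩ := ContinuousMap.exists_restrict_eq hK.isClosed
    (⟨K.domRestrict h, hh.domRestrict⟩ : C(K, ℂ))
  obtain ⟨R, hR⟩ := hK.isBounded.subset_closedBall 0
  refine ⟨fun z => (max 0 (min 1 (R + 1 - ‖z‖)) : ℝ) * g z, by fun_prop, fun z hz => ?_, R + 1,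
    fun z hz => ?_⟩
  · have h1 : ‖z‖ ≤ R := by simpa using hR hz
    have h2 : g z = h z := congrArg (fun k : C(K, ℂ) => k ⟨z, hz⟩) hg
    simp [h2, min_eq_left (show (1 : ℝ) ≤ R + 1 - ‖z‖ by linarith)]
  · have : min 1 (R + 1 - ‖z‖) ≤ 0 := (min_le_right _ _).trans (by linarith)
    simp [max_eq_left this]

/-- **Mergelyan's theorem**: a function continuous on a compact set with connected complement and
holomorphic in its interior is a uniform limit of polynomials. -/
theorem polyApprox_of_continuousOn {K : Set ℂ} (hK : IsCompact K) (hKc : IsConnected Kᶜ)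
    {h : ℂ → ℂ} (hh : ContinuousOn h K) (hd : DifferentiableOn ℂ h (interior K)) :
    PolyApprox K h := by
  obtain ⟨f, hf, hfh, R, hR⟩ := exists_continuous_eqOn_of_isCompact hK hh
  refine PolyApprox.congr (f := f) ?_ hfh
  have hfd : DifferentiableOn ℂ f (interior K) := hd.congr fun z hz => hfh (interior_subset hz)
  have hfs : HasCompactSupport f := HasCompactSupport.intro (isCompact_closedBall 0 R)
    fun v hv => hR v (by rw [mem_closedBall_zero_iff, not_le] at hv; exact hv.le)
  have hfu := hfs.uniformContinuous_of_continuous hf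
  rw [Metric.uniformContinuous_iff] at hfu
  set C := 1 + 2 / Real.pi * ∫ w : ℂ, errorKernel ‖w‖
  have hC : 0 < C := by
    have : 0 ≤ ∫ w : ℂ, errorKernel ‖w‖ :=
      MeasureTheory.integral_nonneg fun w => errorKernel_nonneg (norm_nonneg w)
    positivity
  refine PolyApprox.of_forall_approx fun ε hε => ?_
  obtain ⟨δ, hδ, hδf⟩ := hfu (ε / C) (by positivity)
  have hδ2 : ((δ / 2 : ℝ) : ℂ) ≠ 0 := by exact_mod_cast (half_pos hδ).ne'
  set c : ℂ := ((δ / 2 : ℝ) : ℂ)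
  have hcn : ‖c‖ = δ / 2 := by
    rw [Complex.norm_real, Real.norm_of_nonneg (half_pos hδ).le]
  let e := Homeomorph.mulLeft₀ c hδ2
  have he : ∀ w, e w = c * w := fun _ => rfl
  obtain ⟨F, hF, hFf⟩ := PolyApprox.exists_norm_sub_le (K := e ⁻¹' K) (f := fun w => f (c * w))
    (R := R / ‖c‖) (η := ε / C)
    (e.isCompact_preimage.mpr hK) (by
      rw [← Set.preimage_compl]
      exact e.isConnected_preimage.mpr hKc) (by fun_prop)
    (fun z hz => hR _ (by
      rw [div_le_iff₀ (by rw [hcn]; exact half_pos hδ)] at hz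
      rw [norm_mul]; linarith))
    (by
      rw [← e.preimage_interior]
      exact hfd.comp (by fun_prop) fun w hw => hw)
    (fun x y hxy => by
      rw [← dist_eq_norm]
      refine (hδf ?_).le
      rw [dist_eq_norm, ← mul_sub, norm_mul, hcn]
      nlinarith)
  refine ⟨fun z => F (c⁻¹ * z), PolyApprox.comp_const_mul (c := c⁻¹) ?_ (inv_ne_zero hδ2),
    fun z hz => ?_⟩
  · rw [inv_inv]
    exact hF
  · have := hFf (c⁻¹ * z) (by simpa [he, mul_inv_cancel_left₀ hδ2] using hz)
    rwa [mul_inv_cancel_left₀ hδ2, mul_div_cancel₀ _ hC.ne'] at this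

theorem isPreconnected_ball_diff_closedBall {ρ : ℝ} (hρ : 0 ≤ ρ) (r : ℝ) :
    IsPreconnected (ball (0 : ℂ) r \ closedBall 0 ρ) := by
  have h : ball (0 : ℂ) r \ closedBall 0 ρ
      = (fun x : ℝ × ℝ => (x.1 : ℂ) * Complex.exp (x.2 * Complex.I)) ''
        (Set.Ioo ρ r ×ˢ Set.univ) := by
    ext z
    simp only [Set.mem_sdiff, mem_ball_zero_iff, mem_closedBall_zero_iff, not_le, Set.mem_image,
      Set.mem_prod, Set.mem_Ioo, Set.mem_univ, and_true]
    constructor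
    · rintro ⟨h1, h2⟩
      exact ⟨(‖z‖, z.arg), ⟨h2, h1⟩, Complex.norm_mul_exp_arg_mul_I z⟩
    · rintro ⟨⟨s, θ⟩, ⟨h1, h2⟩, rfl⟩
      simp only [norm_mul, Complex.norm_exp_ofReal_mul_I, mul_one, Complex.norm_real,
        Real.norm_of_nonneg (hρ.trans h1.le)]
      exact ⟨h2, h1⟩
  rw [h]
  exact (isPreconnected_Ioo.prod isPreconnected_univ).image _ (by fun_prop)

theorem isConnected_compl_union_closedBall {K : Set ℂ} (hK : IsClosed K) (hKc : IsConnected Kᶜ)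
    {ρ r : ℝ} (hρ : 0 ≤ ρ) (hρr : ρ < r) (hKr : Disjoint K (ball 0 r)) :
    IsConnected (K ∪ closedBall 0 ρ)ᶜ := by
  have hA : ∀ z ∈ ball (0 : ℂ) r, z ∉ closedBall (0 : ℂ) ρ → z ∈ (K ∪ closedBall 0 ρ)ᶜ :=
    fun z hz hzρ hzK => hzK.elim (fun hzK => hKr.le_bot ⟨hzK, hz⟩) hzρ
  refine ⟨?_, ?_⟩
  · obtain ⟨s, hρs, hsr⟩ := exists_between hρr
    have hs : ‖(s : ℂ)‖ = s := by
      rw [Complex.norm_real, Real.norm_of_nonneg (hρ.trans hρs.le)]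
    exact ⟨(s : ℂ), hA _ (by rwa [mem_ball_zero_iff, hs])
      (by rwa [mem_closedBall_zero_iff, hs, not_le])⟩
  · have hΩ : IsOpen (K ∪ closedBall (0 : ℂ) ρ)ᶜ := (hK.union isClosed_closedBall).isOpen_compl
    have key : ∀ u v : Set ℂ, IsOpen u → IsOpen v → (K ∪ closedBall 0 ρ)ᶜ ⊆ u ∪ v →
        (K ∪ closedBall 0 ρ)ᶜ ∩ (u ∩ v) = ∅ → ball 0 r \ closedBall 0 ρ ⊆ u →
        (K ∪ closedBall 0 ρ)ᶜ ⊆ u := by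
      intro u v hu hv huv hd hAu
      have hmem : ∀ z ∈ (K ∪ closedBall (0 : ℂ) ρ)ᶜ, z ∈ ball (0 : ℂ) r → z ∈ u :=
        fun z hz hzr => hAu ⟨hzr, fun h => hz (.inr h)⟩
      rcases isPreconnected_iff_subset_of_disjoint.mp hKc.isPreconnected
        ((K ∪ closedBall 0 ρ)ᶜ ∩ u ∪ ball 0 r) ((K ∪ closedBall 0 ρ)ᶜ ∩ v)
        ((hΩ.inter hu).union isOpen_ball) (hΩ.inter hv)
        (fun z hz => by
          by_cases hzr : z ∈ ball (0 : ℂ) r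
          · exact .inl (.inr hzr)
          · have hzΩ : z ∈ (K ∪ closedBall (0 : ℂ) ρ)ᶜ := fun h =>
              h.elim hz fun h => hzr (closedBall_subset_ball hρr h)
            exact (huv hzΩ).elim (fun h => .inl (.inl ⟨hzΩ, h⟩)) fun h => .inr ⟨hzΩ, h⟩)
        (Set.eq_empty_of_forall_notMem (by
          rintro z ⟨-, h | h, hzΩ, hzv⟩
          · exact hd.le ⟨hzΩ, h.2, hzv⟩
          · exact hd.le ⟨hzΩ, hmem z hzΩ h, hzv⟩)) with h | h
      · intro z hz
        rcases h (fun hzK => hz (.inl hzK)) with h | h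
        exacts [h.2, hmem z hz h]
      · have h0 : (0 : ℂ) ∈ Kᶜ := fun h0 =>
          hKr.le_bot ⟨h0, mem_ball_self (hρ.trans_lt hρr)⟩
        exact absurd (.inr (mem_closedBall_self hρ)) (h h0).1
    refine isPreconnected_iff_subset_of_disjoint.mpr fun u v hu hv huv hd => ?_
    have hAΩ : ball (0 : ℂ) r \ closedBall 0 ρ ⊆ (K ∪ closedBall 0 ρ)ᶜ := fun z hz => hA z hz.1 hz.2
    refine (isPreconnected_iff_subset_of_disjoint.mp
      (isPreconnected_ball_diff_closedBall hρ r) u v hu hv (hAΩ.trans huv)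
      (Set.eq_empty_of_forall_notMem fun z hz => hd.le ⟨hAΩ hz.1, hz.2⟩)).imp
        (key u v hu hv huv hd)
        (key v u hv hu (Set.union_comm u v ▸ huv) (Set.inter_comm u v ▸ hd))

/-- Simultaneous approximation of `h` on `K` and of `0` on a compact set `B` disjoint from `K`. -/
theorem exists_polynomial_approx_union {K B : Set ℂ} (hK : IsCompact K) (hB : IsCompact B)
    (hKB : Disjoint K B) (hc : IsConnected (K ∪ B)ᶜ) {h : ℂ → ℂ} (hh : ContinuousOn h K)
    (hd : DifferentiableOn ℂ h (interior K)) {ε : ℝ} (hε : 0 < ε) :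
    ∃ P : ℂ[X], (∀ z ∈ K, ‖P.eval z - h z‖ ≤ ε) ∧ ∀ z ∈ B, ‖P.eval z‖ ≤ ε := by
  classical
  have hB0 : Set.EqOn (B.indicator (fun _ => 0) + Bᶜ.indicator h) (fun _ => 0) B :=
    fun z hz => by simp [hz]
  have hKh : Set.EqOn (B.indicator (fun _ => 0) + Bᶜ.indicator h) h Bᶜ :=
    fun z hz => by
      have hz' : z ∉ B := hz
      simp [hz']
  set φ : ℂ → ℂ := B.indicator (fun _ => 0) + Bᶜ.indicator h
  have hsub : K ⊆ Bᶜ := hKB.subset_compl_right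
  obtain ⟨P, hP⟩ := polyApprox_of_continuousOn (hK.union hB) hc (h := φ)
    ((hh.congr (hKh.mono hsub)).union_of_isClosed (continuousOn_const.congr hB0) hK.isClosed
      hB.isClosed)
    (fun z hz => by
      refine DifferentiableAt.differentiableWithinAt ?_
      rcases interior_subset hz with hzK | hzB
      · have hzi : z ∈ interior K := by
          refine interior_maximal (s := K) (t := interior (K ∪ B) ∩ Bᶜ) ?_
            (isOpen_interior.inter hB.isClosed.isOpen_compl) ⟨hz, hsub hzK⟩
          exact fun x hx => (interior_subset hx.1).resolve_right hx.2
        exact (hd.differentiableAt (isOpen_interior.mem_nhds hzi)).congr_of_eventuallyEq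
          (hKh.eventuallyEq_of_mem (hB.isClosed.isOpen_compl.mem_nhds (hsub hzK)))
      · refine (differentiableAt_const (0 : ℂ)).congr_of_eventuallyEq (hB0.eventuallyEq_of_mem ?_)
        filter_upwards [isOpen_interior.mem_nhds hz,
          hK.isClosed.isOpen_compl.mem_nhds fun hzK => hsub hzK hzB] with x hx hxK
        exact (interior_subset hx).resolve_left hxK) ε hε
  refine ⟨P, fun z hz => ?_, fun z hz => ?_⟩
  · rw [← hKh (hsub hz)]
    exact hP z (.inl hz)
  · simpa [hB0 hz] using hP z (.inr hz)

/-- Lemma 4.5 (Mergelyan-type lemma) : given points `w_1, …, w_q` outside `𝔻`, a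
compact `K ⊆ ℂ ∖ (𝔻 ∪ W)` with connected complement, a compact `L ⊆ 𝔻`, `h ∈ A(K)`,
`ε > 0`, values `a_1, …, a_q` and an integer `p ≥ 1`, there is a polynomial `P` of
valuation at least `p` with `P(w_i) ≠ 0`, `P(w_i) ≠ a_i`, `‖P - h‖_K ≤ ε` and
`‖P‖_L ≤ ε`. -/
theorem stmt_11 (q : ℕ) (w : Fin q → ℂ) (hw : ∀ i, 1 ≤ ‖w i‖)
    (K : Set ℂ) (hK : IsCompact K) (hKd : Disjoint K (unitD ∪ Set.range w))
    (hKc : IsConnected Kᶜ)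
    (L : Set ℂ) (hL : IsCompact L) (hLsub : L ⊆ unitD)
    (h : ℂ → ℂ) (hh : ContinuousOn h K) (hh' : DifferentiableOn ℂ h (interior K))
    (ε : ℝ) (hε : 0 < ε) (a : Fin q → ℂ) (p : ℕ) (hp : 1 ≤ p) :
    ∃ P : Polynomial ℂ, (∀ k < p, P.coeff k = 0) ∧
      (∀ i, P.eval (w i) ≠ 0 ∧ P.eval (w i) ≠ a i) ∧
      (∀ z ∈ K, ‖P.eval z - h z‖ ≤ ε) ∧
      (∀ z ∈ L, ‖P.eval z‖ ≤ ε) := by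
  classical
  obtain ⟨r, hr1, hLr⟩ := exists_lt_subset_ball hL.isClosed hLsub
  set ρ := max r 0
  have hρ : ρ < 1 := max_lt hr1 one_pos
  have hLρ : L ⊆ closedBall 0 ρ := hLr.trans (ball_subset_closedBall.trans
    (closedBall_subset_closedBall (le_max_left _ _)))
  have hK1 : Disjoint K (ball 0 1) := hKd.mono_right Set.subset_union_left
  have hK0 : ∀ z ∈ K, z ^ p ≠ 0 := fun z hz hz0 =>
    hK1.le_bot ⟨hz, by simp [eq_zero_of_pow_eq_zero hz0]⟩
  have hBc : IsCompact (closedBall (0 : ℂ) ρ) := isCompact_closedBall 0 ρ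
  obtain ⟨M₀, hM₀⟩ := (hK.union hBc).exists_bound_of_continuousOn
    (f := fun z : ℂ => z ^ p) (by fun_prop)
  set M := max M₀ 1
  have hM : ∀ z ∈ K ∪ closedBall (0 : ℂ) ρ, ‖z ^ p‖ ≤ M :=
    fun z hz => (hM₀ z hz).trans (le_max_left _ _)
  have hM0 : 0 < M := one_pos.trans_le (le_max_right _ _)
  obtain ⟨Q, hQK, hQL⟩ := exists_polynomial_approx_union hK hBc
    (hK1.mono_right (closedBall_subset_ball hρ))
    (isConnected_compl_union_closedBall hK.isClosed hKc (le_max_right _ _) hρ hK1)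
    (h := fun z => h z / z ^ p) (hh.div (by fun_prop) hK0)
    (hh'.div (by fun_prop) fun z hz => hK0 z (interior_subset hz))
    (ε := ε / (2 * M)) (by positivity)
  obtain ⟨t, ht, htw⟩ := (infinite_of_mem_nhds (0 : ℂ)
    (closedBall_mem_nhds 0 (show 0 < ε / (2 * M) by positivity))).exists_notMem_finset
      (Finset.univ.image (fun i => -Q.eval (w i)) ∪
        Finset.univ.image fun i => a i / w i ^ p - Q.eval (w i))
  rw [mem_closedBall_zero_iff] at ht
  simp only [Finset.mem_union, Finset.mem_image, Finset.mem_univ, true_and, not_or,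
    not_exists] at htw
  have hsum : ∀ z ∈ K ∪ closedBall (0 : ℂ) ρ, ∀ x : ℂ, ‖x‖ ≤ ε / (2 * M) →
      ‖z ^ p * (x + t)‖ ≤ ε := fun z hz x hx => by
    rw [norm_mul]
    calc ‖z ^ p‖ * ‖x + t‖ ≤ M * (ε / (2 * M) + ε / (2 * M)) := by
          gcongr
          exacts [hM z hz, (norm_add_le _ _).trans (add_le_add hx ht)]
      _ = ε := by field_simp; norm_num
  refine ⟨X ^ p * (Q + C t), fun k hk => ?_, fun i => ?_, fun z hz => ?_, fun z hz => ?_⟩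
  · rw [coeff_X_pow_mul', if_neg hk.not_ge]
  · have hwi : w i ^ p ≠ 0 := pow_ne_zero _ (norm_pos_iff.mp (one_pos.trans_le (hw i)))
    simp only [eval_mul, eval_pow, eval_X, eval_add, eval_C]
    refine ⟨mul_ne_zero hwi fun h0 => htw.1 i ?_, fun h0 => htw.2 i ?_⟩
    · linear_combination -h0
    · rw [← h0]; field_simp; ring
  · have := hsum z (.inl hz) _ (hQK z hz)
    simp only [eval_mul, eval_pow, eval_X, eval_add, eval_C]
    rwa [sub_add_eq_add_sub, mul_sub, mul_div_cancel₀ _ (hK0 z hz)] at this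
  · have := hsum z (.inr (hLρ hz)) _ (hQL z (hLρ hz))
    simpa only [eval_mul, eval_pow, eval_X, eval_add, eval_C] using this

end
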